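/- arXiv:2008.08555 — 3 statements merged into one kernel-verified Lean document; each statement's English description precedes it below -/
import Mathlib

section
/- Let n ≥ 1, let q ∈ Sp(n), and let B be any orthonormal basis of the real inner product space sp(n). Then for all indices 1 ≤ j, α, k, β ≤ 2n, Σ_{Q∈B} (q·Q)_{jα}·(q·Q)_{kβ} = −(1/2)·q_{kα}·q_{jβ} + (1/2)·(J_n)_{jk}·(J_n)_{αβ}. (Equivalently, the coordinate functions q_{jα} on Sp(n) satisfy κ(q_{jα}, q_{kβ}) = −(1/2)·q_{kα}·q_{jβ} + (1/2)·(J_n)_{jk}·(J_n)_{αβ}, where κ is the conformality operator for the bi-invariant metric.) -/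
open Matrix

/-- The standard complex structure matrix `J_n = [[0, I_n], [-I_n, 0]]` of size `2n × 2n`. -/
def Jmat (n : ℕ) : Matrix (Fin (2 * n)) (Fin (2 * n)) ℂ :=
  Matrix.of fun i j =>
    if (i : ℕ) + n = (j : ℕ) then 1 else if (j : ℕ) + n = (i : ℕ) then -1 else 0

theorem Jmat_apply_swap {n : ℕ} (i j : Fin (2 * n)) : Jmat n i j = -Jmat n j i := by
  simp only [Jmat, of_apply]
  split_ifs <;> first | omega | simp

theorem Jmat_transpose (n : ℕ) : (Jmat n)ᵀ = -Jmat n := by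
  ext i j
  exact Jmat_apply_swap j i

theorem Jmat_conjTranspose (n : ℕ) : (Jmat n)ᴴ = -Jmat n := by
  ext i j
  rw [conjTranspose_apply, Jmat_apply_swap, neg_apply, star_neg]
  simp only [Jmat, of_apply]
  split_ifs <;> simp

theorem Jmat_mul_Jmat (n : ℕ) : Jmat n * Jmat n = -1 := by
  ext i k
  rw [mul_apply, neg_apply, one_apply]
  by_cases hi : (i : ℕ) < n
  · rw [Finset.sum_eq_single (⟨i + n, by omega⟩ : Fin (2 * n))]
    · simp only [Jmat, of_apply, Fin.ext_iff]
      split_ifs <;> first | omega | simp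
    · intro j _ hj
      simp only [Jmat, of_apply, ne_eq, Fin.ext_iff] at hj ⊢
      split_ifs <;> first | omega | simp
    · simp
  · rw [Finset.sum_eq_single (⟨i - n, by omega⟩ : Fin (2 * n))]
    · simp only [Jmat, of_apply, Fin.ext_iff]
      split_ifs <;> first | omega | simp
    · intro j _ hj
      simp only [Jmat, of_apply, ne_eq, Fin.ext_iff] at hj ⊢
      split_ifs <;> first | omega | simp
    · simp

theorem mul_Jmat_add_Jmat_mul_transpose_eq_zero_iff {n : ℕ}
    {X : Matrix (Fin (2 * n)) (Fin (2 * n)) ℂ} :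
    X * Jmat n + Jmat n * Xᵀ = 0 ↔ Jmat n * Xᵀ * Jmat n = X := by
  constructor
  · intro h
    rw [← neg_eq_iff_add_eq_zero] at h
    rw [← h, neg_mul, Matrix.mul_assoc, Jmat_mul_Jmat, mul_neg, mul_one, neg_neg]
  · intro h
    nth_rw 1 [← h]
    rw [Matrix.mul_assoc, Jmat_mul_Jmat, mul_neg, mul_one, neg_add_cancel]

/-- Orthonormal expansion with respect to the inner product `Re tr(Z W*)`. -/
theorem sum_re_trace_smul_of_mem_span {m : Type*} [Fintype m] [DecidableEq m]
    {B : Finset (Matrix m m ℂ)}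
    (honb : ∀ Q ∈ B, ∀ Q' ∈ B, (trace (Q * Q'ᴴ)).re = if Q = Q' then 1 else 0)
    {X : Matrix m m ℂ} (hX : X ∈ Submodule.span ℝ (B : Set (Matrix m m ℂ))) :
    ∑ Q ∈ B, (trace (X * Qᴴ)).re • Q = X := by
  induction hX using Submodule.span_induction with
  | mem X hX =>
    rw [Finset.sum_congr rfl fun Q hQ => by rw [honb X hX Q hQ]]
    simpa using fun h => absurd (Finset.mem_coe.mp hX) h
  | zero => simp
  | add X Y _ _ hX hY =>
    simp only [add_mul, trace_add, Complex.add_re, add_smul, Finset.sum_add_distrib, hX, hY]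
  | smul a X _ hX =>
    simp only [smul_mul_assoc, trace_smul, Complex.smul_re, smul_assoc, ← Finset.smul_sum, hX]

theorem ofReal_re_trace_mul_conjTranspose {m : Type*} [Fintype m] {X Q : Matrix m m ℂ}
    (hX : Xᴴ = -X) (hQ : Qᴴ = -Q) : ((trace (X * Qᴴ)).re : ℂ) = -trace (X * Q) := by
  have h : trace (X * Qᴴ) = -trace (X * Q) := by rw [hQ, mul_neg, trace_neg]
  rw [← h]
  refine Complex.conj_eq_iff_re.mp ?_
  rw [starRingEnd_apply, ← trace_conjTranspose, conjTranspose_mul, conjTranspose_conjTranspose,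
    hX, hQ, mul_neg, mul_neg, trace_neg, trace_neg, trace_mul_comm]

theorem mul_single_one_mul_apply {m R : Type*} [Fintype m] [DecidableEq m] [Semiring R]
    (A C : Matrix m m R) (a b i j : m) :
    (A * (single i j 1 : Matrix m m R) * C) a b = A a i * C j b := by
  simp [mul_apply, single_apply, ite_and]

section SymplecticBasis

variable {n : ℕ} {B : Finset (Matrix (Fin (2 * n)) (Fin (2 * n)) ℂ)}

/-- Expansion of elements of the complexification of `sp(n)` in an orthonormal basis of `sp(n)`. -/
theorem sum_trace_mul_smul (hskew : ∀ Q ∈ B, Qᴴ = -Q)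
    (honb : ∀ Q ∈ B, ∀ Q' ∈ B, (trace (Q * Q'ᴴ)).re = if Q = Q' then 1 else 0)
    (hspan : ∀ X : Matrix (Fin (2 * n)) (Fin (2 * n)) ℂ,
      Xᴴ = -X → X * Jmat n + Jmat n * Xᵀ = 0 →
      X ∈ Submodule.span ℝ (B : Set (Matrix (Fin (2 * n)) (Fin (2 * n)) ℂ)))
    {M : Matrix (Fin (2 * n)) (Fin (2 * n)) ℂ} (hM : Jmat n * Mᵀ * Jmat n = M) :
    ∑ Q ∈ B, trace (M * Q) • Q = -M := by
  have hsp {X : Matrix (Fin (2 * n)) (Fin (2 * n)) ℂ} (hX : Xᴴ = -X)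
      (hXJ : Jmat n * Xᵀ * Jmat n = X) : ∑ Q ∈ B, trace (X * Q) • Q = -X := by
    rw [← neg_inj, neg_neg, ← Finset.sum_neg_distrib]
    conv_rhs => rw [← sum_re_trace_smul_of_mem_span honb
      (hspan X hX (mul_Jmat_add_Jmat_mul_transpose_eq_zero_iff.mpr hXJ))]
    refine Finset.sum_congr rfl fun Q hQ => ?_
    rw [← neg_smul, ← ofReal_re_trace_mul_conjTranspose hX (hskew Q hQ), Complex.coe_smul]
  have hMH : Jmat n * Mᴴᵀ * Jmat n = Mᴴ := by
    conv_rhs => rw [← hM]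
    simp only [conjTranspose_mul, Jmat_conjTranspose, neg_mul, mul_neg, neg_neg, Matrix.mul_assoc]
    rfl
  have h₁ := hsp (X := M - Mᴴ) (by simp)
    (by rw [transpose_sub, mul_sub, sub_mul, hM, hMH])
  have h₂ := hsp (X := Complex.I • (M + Mᴴ)) (by simp [add_comm])
    (by rw [transpose_smul, transpose_add, mul_smul_comm, smul_mul_assoc, mul_add, add_mul, hM,
      hMH])
  have h₃ : M = (1 / 2 : ℂ) • (M - Mᴴ) + (-Complex.I / 2) • Complex.I • (M + Mᴴ) := by
    rw [smul_smul, show -Complex.I / 2 * Complex.I = 1 / 2 by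
      linear_combination (-1 / 2 : ℂ) * Complex.I_mul_I]
    module
  generalize M - Mᴴ = X at *
  generalize Complex.I • (M + Mᴴ) = Y at *
  rw [h₃]
  simp only [add_mul, smul_mul_assoc, trace_add, trace_smul, add_smul, Finset.sum_add_distrib,
    smul_assoc, ← Finset.smul_sum, h₁, h₂]
  module

/-- Expansion of the projection of an arbitrary complex matrix to the complexification
of `sp(n)`. -/
theorem two_smul_sum_trace_mul_smul (hskew : ∀ Q ∈ B, Qᴴ = -Q)
    (hsymp : ∀ Q ∈ B, Q * Jmat n + Jmat n * Qᵀ = 0)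
    (honb : ∀ Q ∈ B, ∀ Q' ∈ B, (trace (Q * Q'ᴴ)).re = if Q = Q' then 1 else 0)
    (hspan : ∀ X : Matrix (Fin (2 * n)) (Fin (2 * n)) ℂ,
      Xᴴ = -X → X * Jmat n + Jmat n * Xᵀ = 0 →
      X ∈ Submodule.span ℝ (B : Set (Matrix (Fin (2 * n)) (Fin (2 * n)) ℂ)))
    (M : Matrix (Fin (2 * n)) (Fin (2 * n)) ℂ) :
    (2 : ℂ) • ∑ Q ∈ B, trace (M * Q) • Q = -(Jmat n * Mᵀ * Jmat n + M) := by
  rw [← sum_trace_mul_smul hskew honb hspan (M := Jmat n * Mᵀ * Jmat n + M), Finset.smul_sum]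
  · refine Finset.sum_congr rfl fun Q hQ => ?_
    have h : trace (Jmat n * Mᵀ * Jmat n * Q) = trace (M * Q) := by
      conv_rhs => rw [← mul_Jmat_add_Jmat_mul_transpose_eq_zero_iff.mp (hsymp Q hQ)]
      rw [← trace_transpose, trace_mul_comm M]
      simp only [transpose_mul, transpose_transpose, Jmat_transpose, neg_mul, mul_neg, neg_neg]
      simp only [← Matrix.mul_assoc]
      rw [trace_mul_comm]
      simp only [Matrix.mul_assoc]
    rw [add_mul, trace_add, h, smul_smul, two_mul (trace _)]
  · simp only [transpose_add, transpose_mul, transpose_transpose, Jmat_transpose, neg_mul, mul_neg,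
      neg_neg, mul_add, add_mul]
    rw [add_comm]
    congr 1
    simp only [← Matrix.mul_assoc, Jmat_mul_Jmat]
    simp [Matrix.mul_assoc, Jmat_mul_Jmat]

end SymplecticBasis

/-- **Conformality operator on the coordinate functions of Sp(n).**
For `q ∈ Sp(n)` and any orthonormal basis `B` of `sp(n)` (the skew-Hermitian `2n × 2n`
matrices `Q` with `Q J_n + J_n Qᵗ = 0`, inner product `⟨Z,W⟩ = Re tr(Z W*)`),
`∑_{Q ∈ B} (qQ)_{jα} (qQ)_{kβ} = -(1/2) q_{kα} q_{jβ} + (1/2)(J_n)_{jk}(J_n)_{αβ}`. -/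
theorem stmt_9 (n : ℕ) (hn : 1 ≤ n)
    (q : Matrix (Fin (2 * n)) (Fin (2 * n)) ℂ)
    (hq : q ∈ Matrix.unitaryGroup (Fin (2 * n)) ℂ)
    (hqJ : q * Jmat n * qᵀ = Jmat n)
    (B : Finset (Matrix (Fin (2 * n)) (Fin (2 * n)) ℂ))
    (hskew : ∀ Q ∈ B, Qᴴ = -Q)
    (hsymp : ∀ Q ∈ B, Q * Jmat n + Jmat n * Qᵀ = 0)
    (honb : ∀ Q ∈ B, ∀ Q' ∈ B,
      (Matrix.trace (Q * Q'ᴴ)).re = if Q = Q' then 1 else 0)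
    (hspan : ∀ X : Matrix (Fin (2 * n)) (Fin (2 * n)) ℂ,
      Xᴴ = -X → X * Jmat n + Jmat n * Xᵀ = 0 →
      X ∈ Submodule.span ℝ (B : Set (Matrix (Fin (2 * n)) (Fin (2 * n)) ℂ)))
    (j α k β : Fin (2 * n)) :
    ∑ Q ∈ B, (q * Q) j α * (q * Q) k β =
      -(1 / 2) * (q k α * q j β) + (1 / 2) * (Jmat n j k * Jmat n α β) := by
  have hP : Jmat n * (single α j (1 : ℂ) * q)ᵀ * Jmat n + single α j 1 * q =
      -(2 : ℂ) • ∑ Q ∈ B, trace (single α j 1 * q * Q) • Q := by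
    rw [← neg_inj, neg_smul, neg_neg]
    exact (two_smul_sum_trace_mul_smul hskew hsymp honb hspan _).symm
  have htr (Q : Matrix (Fin (2 * n)) (Fin (2 * n)) ℂ) :
      trace (single α j 1 * q * Q) = (q * Q) j α := by
    rw [Matrix.mul_assoc, trace_single_mul, one_smul]
  have hJ : q * (Jmat n * (single α j (1 : ℂ) * q)ᵀ * Jmat n) =
      Jmat n * single j α 1 * Jmat n := by
    rw [transpose_mul, transpose_single]
    simp only [← Matrix.mul_assoc, hqJ]
  have h := congrArg (fun M => (q * M) k β) hP
  simp only [mul_add, hJ, htr, mul_smul_comm, Finset.mul_sum, Matrix.add_apply, Matrix.smul_apply,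
    Matrix.sum_apply, smul_eq_mul, ← Matrix.mul_assoc q, mul_single_one_mul_apply] at h
  rw [Jmat_apply_swap k j, ← Finset.mul_sum] at h
  linear_combination (1 / 2 : ℂ) * h
end

section
/- Let n ≥ 1, let z ∈ SU(n), and let B be any orthonormal basis of the real inner product space su(n). Then for all indices 1 ≤ j, α, k, β ≤ n, Σ_{Q∈B} (z·Q)_{jα}·(z·Q)_{kβ} = −z_{jβ}·z_{kα} + (1/n)·z_{jα}·z_{kβ}. (Equivalently, the coordinate functions z_{jα} on SU(n) satisfy κ(z_{jα}, z_{kβ}) = −z_{jβ}z_{kα} + (1/n)·z_{jα}z_{kβ}, where κ is the conformality operator for the bi-invariant metric.) -/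
open Matrix

namespace Matrix

variable {m : Type*} [Fintype m]

/-- The trace pairing of two skew-Hermitian matrices is real. -/
lemma trace_mul_eq_ofReal_of_skew {X Y : Matrix m m ℂ} (hX : Xᴴ = -X) (hY : Yᴴ = -Y) :
    trace (X * Y) = ((trace (X * Y)).re : ℂ) := by
  refine (Complex.conj_eq_iff_re.mp ?_).symm
  change star (trace (X * Y)) = _
  rw [← trace_conjTranspose, conjTranspose_mul, hX, hY, neg_mul_neg, trace_mul_comm]

/-- The complex-linear map `M ↦ M + ∑ Q ∈ B, tr(M Q) Q`. -/
noncomputable def traceDefect (B : Finset (Matrix m m ℂ)) :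
    Matrix m m ℂ →ₗ[ℂ] Matrix m m ℂ where
  toFun M := M + ∑ Q ∈ B, trace (M * Q) • Q
  map_add' M N := by
    simp only [add_mul, trace_add, add_smul, Finset.sum_add_distrib]
    abel
  map_smul' c M := by
    simp [smul_add, Finset.smul_sum, smul_smul]

lemma traceDefect_apply (B : Finset (Matrix m m ℂ)) (M : Matrix m m ℂ) :
    traceDefect B M = M + ∑ Q ∈ B, trace (M * Q) • Q := rfl

/-- `traceDefect B` vanishes on the real span of `B`, for `B` an orthonormal set of
skew-Hermitian matrices. -/
lemma traceDefect_eq_zero_of_mem_span [DecidableEq (Matrix m m ℂ)] {B : Finset (Matrix m m ℂ)}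
    (hskew : ∀ Q ∈ B, Qᴴ = -Q)
    (honb : ∀ Q ∈ B, ∀ Q' ∈ B, (trace (Q * Q'ᴴ)).re = if Q = Q' then 1 else 0)
    {X : Matrix m m ℂ} (hX : X ∈ Submodule.span ℝ (B : Set (Matrix m m ℂ))) :
    traceDefect B X = 0 := by
  suffices h : Submodule.span ℝ (B : Set (Matrix m m ℂ)) ≤
      (LinearMap.ker (traceDefect B)).restrictScalars ℝ from h hX
  refine Submodule.span_le.mpr fun P hP => ?_
  have hP : P ∈ B := hP
  have key : ∀ Q ∈ B, trace (P * Q) • Q = if P = Q then -Q else 0 := by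
    intro Q hQ
    have h := honb P hP Q hQ
    rw [hskew Q hQ, mul_neg, trace_neg, Complex.neg_re, neg_eq_iff_eq_neg] at h
    rw [trace_mul_eq_ofReal_of_skew (hskew P hP) (hskew Q hQ), h]
    split_ifs <;> simp
  change traceDefect B P = 0
  rw [traceDefect_apply, Finset.sum_congr rfl key, Finset.sum_ite_eq, if_pos hP,
    add_neg_cancel]

/-- A complex-linear map that vanishes on traceless skew-Hermitian matrices vanishes on all
traceless matrices. -/
lemma apply_eq_zero_of_trace_eq_zero {V : Type*} [AddCommGroup V] [Module ℂ V]
    (f : Matrix m m ℂ →ₗ[ℂ] V) (hf : ∀ X : Matrix m m ℂ, Xᴴ = -X → trace X = 0 → f X = 0)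
    {M : Matrix m m ℂ} (hM : trace M = 0) : f M = 0 := by
  have hM' : trace Mᴴ = 0 := by rw [trace_conjTranspose, hM, star_zero]
  have h₁ : f (M - Mᴴ) = 0 := hf _ (by simp) (by rw [trace_sub, hM, hM', sub_zero])
  have h₂ : f (Complex.I • (M + Mᴴ)) = 0 :=
    hf _ (by simp [conjTranspose_smul, add_comm]) (by simp [hM, hM'])
  have h₃ : f (M + Mᴴ) = 0 := by
    rw [map_smul] at h₂
    exact (smul_eq_zero.mp h₂).resolve_left Complex.I_ne_zero
  have h₄ : (2 : ℂ) • f M = 0 := by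
    rw [← map_smul, show (2 : ℂ) • M = (M - Mᴴ) + (M + Mᴴ) by rw [two_smul]; abel,
      map_add, h₁, h₃, add_zero]
  exact (smul_eq_zero.mp h₄).resolve_left two_ne_zero

end Matrix

/-- **Conformality operator on the coordinate functions of SU(n).**
For `z ∈ SU(n)`, any orthonormal basis `B` of `su(n)` (the traceless skew-Hermitian
`n × n` matrices with inner product `⟨Z,W⟩ = Re tr(Z W*)`), and all indices `j, α, k, β`,
`∑_{Q ∈ B} (zQ)_{jα} (zQ)_{kβ} = -z_{jβ} z_{kα} + (1/n) z_{jα} z_{kβ}`. -/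
theorem stmt_13 (n : ℕ) (hn : 1 ≤ n)
    (z : Matrix (Fin n) (Fin n) ℂ)
    (hz : z ∈ Matrix.unitaryGroup (Fin n) ℂ)
    (hzdet : z.det = 1)
    (B : Finset (Matrix (Fin n) (Fin n) ℂ))
    (hskew : ∀ Q ∈ B, Qᴴ = -Q)
    (htr : ∀ Q ∈ B, Matrix.trace Q = 0)
    (honb : ∀ Q ∈ B, ∀ Q' ∈ B,
      (Matrix.trace (Q * Q'ᴴ)).re = if Q = Q' then 1 else 0)
    (hspan : ∀ X : Matrix (Fin n) (Fin n) ℂ, Xᴴ = -X → Matrix.trace X = 0 →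
      X ∈ Submodule.span ℝ (B : Set (Matrix (Fin n) (Fin n) ℂ)))
    (j α k β : Fin n) :
    ∑ Q ∈ B, (z * Q) j α * (z * Q) k β =
      -(z j β * z k α) + (1 / (n : ℂ)) * (z j α * z k β) := by
  have hn0 : (n : ℂ) ≠ 0 := by exact_mod_cast (by omega : n ≠ 0)
  let E : Matrix (Fin n) (Fin n) ℂ := single α j 1 * z
  have hE : ∀ Q : Matrix (Fin n) (Fin n) ℂ, trace (E * Q) = (z * Q) j α := fun Q => by
    simp [E, Matrix.mul_assoc, trace_single_mul]
  have hEtr : trace E = z j α := by simpa using hE 1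
  have hzero : traceDefect B (E - (z j α / n) • 1) = 0 :=
    apply_eq_zero_of_trace_eq_zero _
      (fun X hX hX' => traceDefect_eq_zero_of_mem_span hskew honb (hspan X hX hX'))
      (by simp [trace_sub, trace_smul, hEtr, hn0])
  have hsum : ∑ Q ∈ B, (z * Q) j α • Q = (z j α / n) • 1 - E := by
    rw [traceDefect_apply, Finset.sum_congr rfl fun Q hQ => show _ = (z * Q) j α • Q by
      simp [sub_mul, trace_sub, hE, htr Q hQ]] at hzero
    rw [eq_neg_of_add_eq_zero_right hzero, neg_sub]
  have hentry := congrArg (fun M : Matrix (Fin n) (Fin n) ℂ => (z * M) k β) hsum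
  have hzE : (z * E) k β = z k α * z j β := by
    simp [E, Matrix.mul_apply, single_apply, ite_and]
  simp only [Finset.mul_sum, Matrix.mul_smul, Matrix.sum_apply, Matrix.smul_apply, smul_eq_mul,
    Matrix.mul_sub, Matrix.sub_apply, Matrix.mul_one, hzE] at hentry
  rw [hentry]
  ring
end

section
/- Let x and y be n×n real matrices such that the complex matrix x + iy is unitary, i.e. (x+iy)·(x+iy)* = I_n. Then the 2n×2n real block matrix [[x, y], [−y, x]] belongs to SO(2n), i.e. it is orthogonal with determinant 1. -/
open Matrix

/-- The real and imaginary parts of the unitarity relation `(x + iy)(x + iy)ᴴ = 1`. -/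
theorem Matrix.re_im_of_mul_conjTranspose_eq_one {n : Type*} [Fintype n] [DecidableEq n]
    {x y : Matrix n n ℝ}
    (h : (x.map (Complex.ofReal) + Complex.I • y.map (Complex.ofReal)) *
      (x.map (Complex.ofReal) + Complex.I • y.map (Complex.ofReal))ᴴ = 1) :
    x * xᵀ + y * yᵀ = 1 ∧ x * yᵀ = y * xᵀ := by
  constructor
  · ext i j
    have hij := congr(Complex.re ($h i j))
    simpa [Matrix.mul_apply, Matrix.one_apply, apply_ite Complex.re,
      Finset.sum_add_distrib] using hij
  · ext i j
    have hij := congr(Complex.im ($h i j))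
    simp [Matrix.mul_apply, Matrix.one_apply, apply_ite Complex.im,
      Finset.sum_add_distrib] at hij ⊢
    linarith

/-- **The standard embedding of U(n) into SO(2n).**
If `x, y` are real `n × n` matrices such that `x + iy` is unitary, then the block matrix
`[[x, y], [-y, x]]` is orthogonal with determinant `1`, i.e. it lies in `SO(2n)`. -/
theorem stmt_19 (n : ℕ) (x y : Matrix (Fin n) (Fin n) ℝ)
    (h : (x.map (Complex.ofReal) + Complex.I • y.map (Complex.ofReal)) *
      (x.map (Complex.ofReal) + Complex.I • y.map (Complex.ofReal))ᴴ = 1) :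
    Matrix.fromBlocks x y (-y) x ∈ Matrix.orthogonalGroup (Fin n ⊕ Fin n) ℝ ∧
      (Matrix.fromBlocks x y (-y) x).det = 1 := by
  obtain ⟨hre, him⟩ := Matrix.re_im_of_mul_conjTranspose_eq_one h
  constructor
  · rw [Matrix.mem_orthogonalGroup_iff, Matrix.fromBlocks_transpose,
      Matrix.fromBlocks_multiply, ← Matrix.fromBlocks_one]
    simp [hre, him, add_comm (y * yᵀ)]
  · apply SymplecticGroup.det_eq_one
    rw [SymplecticGroup.mem_iff, Matrix.J, Matrix.fromBlocks_transpose,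
      Matrix.fromBlocks_multiply, Matrix.fromBlocks_multiply]
    simp [hre, him, ← neg_add, add_comm (y * yᵀ)]
end
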